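/- arXiv:2407.09301 — 3 statements merged into one kernel-verified Lean document; each statement's English description precedes it below -/
import Mathlib

section
/- Let μ(dx) = e^{−V(x)} dx be a probability measure on ℝⁿ with V of class C², and suppose ∇²V(x) ≥ α·Id for all x with α > 0. Then μ satisfies the Poincaré inequality with constant 1/α: var_μ(f) ≤ (1/α) ∫ |∇f|² dμ for all smooth compactly supported f. -/
open MeasureTheory RealInnerProductSpace
open scoped ENNReal

theorem volume_add_volume_le_of_isCompact {K L C : Set ℝ} (hK : IsCompact K) (hL : IsCompact L)
    (hK0 : K.Nonempty) (hL0 : L.Nonempty) (h : ∀ x ∈ K, ∀ y ∈ L, 2⁻¹ * (x + y) ∈ C) :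
    volume K + volume L ≤ 2 * volume C := by
  obtain ⟨k, hk, hk_max⟩ := hK.exists_isGreatest hK0
  obtain ⟨l, hl, hl_min⟩ := hL.exists_isLeast hL0
  have hinter : volume ((fun x => -l + x) ⁻¹' K ∩ (fun y => -k + y) ⁻¹' L) = 0 := by
    refine measure_mono_null (t := {k + l}) (fun z hz => ?_) (measure_singleton _)
    have h1 := hk_max hz.1
    have h2 := hl_min hz.2
    simp only [Set.mem_singleton_iff] at *
    linarith
  have hmeas : MeasurableSet ((fun y => -k + y) ⁻¹' L) :=
    hL.measurableSet.preimage (measurable_const_add _)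
  have hsum := measure_union_add_inter (μ := volume) ((fun x => -l + x) ⁻¹' K) hmeas
  rw [hinter, add_zero, measure_preimage_add, measure_preimage_add] at hsum
  have hC : volume ((fun z => 2⁻¹ * z) ⁻¹' C) = 2 * volume C := by
    rw [Real.volume_preimage_mul_left (by norm_num)]
    norm_num
  rw [← hsum, ← hC]
  refine measure_mono ?_
  rintro z (hz | hz)
  · simpa using h _ hz _ hl
  · simpa using h _ hk _ hz

/-- The one-dimensional Brunn–Minkowski inequality for midpoints. -/
theorem volume_add_volume_le {A B C : Set ℝ} (hA : MeasurableSet A) (hB : MeasurableSet B)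
    (hA0 : A.Nonempty) (hB0 : B.Nonempty) (h : ∀ x ∈ A, ∀ y ∈ B, 2⁻¹ * (x + y) ∈ C) :
    volume A + volume B ≤ 2 * volume C := by
  obtain ⟨a, ha⟩ := hA0
  obtain ⟨b, hb⟩ := hB0
  rw [hA.measure_eq_iSup_isCompact, hB.measure_eq_iSup_isCompact]
  simp_rw [iSup_and']
  refine ENNReal.biSup_add_biSup_le' ⟨∅, Set.empty_subset _, isCompact_empty⟩
    ⟨∅, Set.empty_subset _, isCompact_empty⟩ fun K hK L hL => ?_
  calc volume K + volume L ≤ volume (insert a K) + volume (insert b L) := by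
        gcongr <;> exact Set.subset_insert _ _
    _ ≤ 2 * volume C :=
        volume_add_volume_le_of_isCompact (hK.2.insert a) (hL.2.insert b)
          (Set.insert_nonempty _ _) (Set.insert_nonempty _ _) fun x hx y hy =>
            h x (Set.insert_subset ha hK.1 hx) y (Set.insert_subset hb hL.1 hy)

/-- The Prékopa–Leindler inequality on `ℝ` for functions whose suprema exceed `1`. -/
theorem lintegral_min_one_add_le {u v w : ℝ → ℝ≥0∞} (hu : Measurable u) (hv : Measurable v)
    (hw : Measurable w) (hu1 : ∃ x, 1 < u x) (hv1 : ∃ y, 1 < v y)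
    (h : ∀ x y, min (u x) (v y) ≤ w (2⁻¹ * (x + y))) :
    (∫⁻ x, min (u x) 1) + ∫⁻ y, min (v y) 1 ≤ 2 * ∫⁻ z, w z := by
  have layer : ∀ f : ℝ → ℝ≥0∞, Measurable f →
      ∫⁻ x, min (f x) 1 = ∫⁻ t in Set.Ioi 0, volume {x | t < (min (f x) 1).toReal} := by
    intro f hf
    rw [← lintegral_eq_lintegral_meas_lt]
    · refine lintegral_congr fun x => (ENNReal.ofReal_toReal ?_).symm
      exact ((min_le_right _ _).trans_lt ENNReal.one_lt_top).ne
    · exact ae_of_all _ fun x => ENNReal.toReal_nonneg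
    · exact (hf.min measurable_const).ennreal_toReal.aemeasurable
  have hlt : ∀ {t : ℝ}, 0 < t → t < 1 → ∀ a : ℝ≥0∞,
      t < (min a 1).toReal ↔ ENNReal.ofReal t < a := by
    intro t ht0 ht a
    rw [← ENNReal.ofReal_lt_iff_lt_toReal ht0.le
      ((min_le_right _ _).trans_lt ENNReal.one_lt_top).ne, lt_min_iff]
    simp [ht]
  have hle : ∫⁻ z, min (w z) 1 ≤ ∫⁻ z, w z := lintegral_mono fun z => min_le_left _ _
  refine le_trans ?_ (mul_le_mul_right hle 2)
  have hmono : ∀ f : ℝ → ℝ≥0∞, Antitone fun t : ℝ => volume {x | t < (min (f x) 1).toReal} :=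
    fun f s t hst => measure_mono fun x hx => hst.trans_lt hx
  rw [layer u hu, layer v hv, layer w hw, ← lintegral_add_left (hmono u).measurable,
    ← lintegral_const_mul _ (hmono w).measurable]
  refine setLIntegral_mono ((hmono w).measurable.const_mul 2) fun t ht => ?_
  rcases lt_or_ge t 1 with ht1 | ht1
  · simp_rw [hlt ht ht1]
    have h1 : ENNReal.ofReal t < 1 := by simpa using ht1
    refine volume_add_volume_le (measurableSet_lt measurable_const hu)
      (measurableSet_lt measurable_const hv) (hu1.imp fun x hx => h1.trans hx)
      (hv1.imp fun x hx => h1.trans hx) fun x hx y hy => ?_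
    exact (lt_min hx hy).trans_le (h x y)
  · have hempty : ∀ f : ℝ → ℝ≥0∞, {x | t < (min (f x) 1).toReal} = ∅ := by
      intro f
      refine Set.eq_empty_of_forall_notMem fun x hx => ?_
      have : (min (f x) 1).toReal ≤ 1 :=
        ENNReal.toReal_le_of_le_ofReal zero_le_one (by simp)
      exact absurd (hx.trans_le this) (not_lt.2 ht1)
    simp [hempty]

theorem mul_le_sq_of_add_le_two_mul {p q r : ℝ≥0∞} (h : p + q ≤ 2 * r) : p * q ≤ r ^ 2 := by
  rcases eq_or_ne r ⊤ with rfl | hr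
  · simp
  have hpq : p + q ≠ ⊤ := (h.trans_lt (ENNReal.mul_lt_top (by simp) hr.lt_top)).ne
  lift p to NNReal using fun h => hpq (by simp [h])
  lift q to NNReal using fun h => hpq (by simp [h])
  lift r to NNReal using hr
  norm_cast at h ⊢
  have h' : (p : ℝ) + q ≤ 2 * r := by exact_mod_cast h
  have : (p : ℝ) * q ≤ r ^ 2 := by
    nlinarith [sq_nonneg ((p : ℝ) - q), p.2, q.2, r.2, mul_self_le_mul_self (by positivity) h']
  exact_mod_cast this

/-- The property of satisfying the Prékopa–Leindler inequality for midpoints. -/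
def PrekopaLeindler {E : Type*} [AddCommGroup E] [Module ℝ E] [MeasurableSpace E]
    (μ : Measure E) : Prop :=
  ∀ u v w : E → ℝ≥0∞, Measurable u → Measurable v → Measurable w →
    (∀ x y, u x * v y ≤ w ((2⁻¹ : ℝ) • (x + y)) ^ 2) →
    (∫⁻ x, u x ∂μ) * ∫⁻ y, v y ∂μ ≤ (∫⁻ z, w z ∂μ) ^ 2

theorem lintegral_min_mul_lintegral_min_le {u v w : ℝ → ℝ≥0∞} (hu : Measurable u)
    (hv : Measurable v) (hw : Measurable w) (h : ∀ x y, u x * v y ≤ w (2⁻¹ * (x + y)) ^ 2)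
    {a b : ℝ≥0∞} (ha : 0 < a) (hb : 0 < b) (hua : ∃ x, a < u x) (hvb : ∃ y, b < v y) :
    (∫⁻ x, min (u x) a) * ∫⁻ y, min (v y) b ≤ (∫⁻ z, w z) ^ 2 := by
  have ha' : a ≠ ⊤ := hua.elim fun x hx => hx.ne_top
  have hb' : b ≠ ⊤ := hvb.elim fun x hx => hx.ne_top
  obtain ⟨c, hc⟩ : ∃ c : ℝ≥0∞, c ^ 2 = a * b := by
    lift a to NNReal using ha'
    lift b to NNReal using hb'
    exact ⟨NNReal.sqrt (a * b), by norm_cast; exact NNReal.sq_sqrt _⟩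
  have hc0 : c ≠ 0 := by
    rintro rfl
    simp [ha.ne', hb.ne', eq_comm] at hc
  have hct : c ≠ ⊤ := by
    rintro rfl
    exact ENNReal.mul_ne_top ha' hb' (by simpa using hc.symm)
  have key := mul_le_sq_of_add_le_two_mul <| lintegral_min_one_add_le (u := fun x => u x * a⁻¹)
    (v := fun x => v x * b⁻¹) (w := fun x => w x * c⁻¹) (hu.mul_const _) (hv.mul_const _)
    (hw.mul_const _)
    (hua.imp fun x hx => by
      rw [← div_eq_mul_inv]
      exact (ENNReal.lt_div_iff_mul_lt (.inl ha.ne') (.inl ha')).2 (by simpa using hx))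
    (hvb.imp fun x hx => by
      rw [← div_eq_mul_inv]
      exact (ENNReal.lt_div_iff_mul_lt (.inl hb.ne') (.inl hb')).2 (by simpa using hx))
    (fun x y => by
      rw [← ENNReal.pow_le_pow_left_iff two_ne_zero, mul_pow, ← ENNReal.inv_pow, hc]
      calc _ ≤ (u x * a⁻¹) * (v y * b⁻¹) := by
            rw [sq]; exact mul_le_mul' (min_le_left _ _) (min_le_right _ _)
        _ = (u x * v y) * (a * b)⁻¹ := by
            rw [ENNReal.mul_inv (.inl ha.ne') (.inl ha')]; ring
        _ ≤ _ := by gcongr; exact h x y)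
  have hscale : ∀ (f : ℝ → ℝ≥0∞), Measurable f → ∀ d : ℝ≥0∞, d ≠ 0 → d ≠ ⊤ →
      ∫⁻ x, min (f x) d = d * ∫⁻ x, min (f x * d⁻¹) 1 := by
    intro f hf d hd hd'
    rw [← lintegral_const_mul _ ((hf.mul_const _).min measurable_const)]
    refine lintegral_congr fun x => ?_
    rw [mul_min, mul_one, mul_left_comm, ENNReal.mul_inv_cancel hd hd', mul_one]
  rw [hscale u hu a ha.ne' ha', hscale v hv b hb.ne' hb']
  rw [lintegral_mul_const _ hw] at key
  calc _ = (a * b) * ((∫⁻ x, min (u x * a⁻¹) 1) * ∫⁻ x, min (v x * b⁻¹) 1) := by ring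
    _ ≤ c ^ 2 * ((∫⁻ z, w z) * c⁻¹) ^ 2 := by rw [hc]; gcongr
    _ = (∫⁻ z, w z) ^ 2 * (c * c⁻¹) ^ 2 := by ring
    _ = _ := by rw [ENNReal.mul_inv_cancel hc0 hct]; simp

theorem exists_seq_lintegral_eq_iSup_min {u : ℝ → ℝ≥0∞} (hu : Measurable u)
    (h0 : ∫⁻ x, u x ≠ 0) : ∃ a : ℕ → ℝ≥0∞, (∀ n, 0 < a n ∧ ∃ x, a n < u x) ∧
      ∫⁻ x, u x = ⨆ n, ∫⁻ x, min (u x) (a n) := by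
  have hpos : 0 < ⨆ x, u x := by
    refine pos_iff_ne_zero.2 fun h => h0 ?_
    simp [ENNReal.iSup_eq_zero.1 h]
  obtain ⟨a, ha, hmem, hlim⟩ := exists_seq_strictMono_tendsto' hpos
  refine ⟨a, fun n => ⟨(hmem n).1, lt_iSup_iff.1 (hmem n).2⟩, ?_⟩
  rw [← lintegral_iSup (fun n => hu.min measurable_const)
    (fun m n hmn x => min_le_min_left _ (ha.monotone hmn))]
  refine lintegral_congr fun x => ?_
  rw [← inf_iSup_eq, iSup_eq_of_tendsto ha.monotone hlim]
  exact (inf_eq_left.2 (le_iSup u x)).symm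

theorem prekopaLeindler_real : PrekopaLeindler (volume : Measure ℝ) := by
  intro u v w hu hv hw h
  rcases eq_or_ne (∫⁻ x, u x) 0 with hu0 | hu0
  · simp [hu0]
  rcases eq_or_ne (∫⁻ x, v x) 0 with hv0 | hv0
  · simp [hv0]
  obtain ⟨a, ha, hua⟩ := exists_seq_lintegral_eq_iSup_min hu hu0
  obtain ⟨b, hb, hvb⟩ := exists_seq_lintegral_eq_iSup_min hv hv0
  rw [hua, hvb, ENNReal.iSup_mul]
  refine iSup_le fun m => ?_
  rw [ENNReal.mul_iSup]
  exact iSup_le fun n =>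
    lintegral_min_mul_lintegral_min_le hu hv hw h (ha m).1 (hb n).1 (ha m).2 (hb n).2

section

variable {E F : Type*} [AddCommGroup E] [Module ℝ E] [MeasurableSpace E]
  [AddCommGroup F] [Module ℝ F] [MeasurableSpace F] {μ : Measure E} {ν : Measure F}

theorem PrekopaLeindler.prod [SFinite μ] [SFinite ν] (hμ : PrekopaLeindler μ)
    (hν : PrekopaLeindler ν) : PrekopaLeindler (μ.prod ν) := by
  intro u v w hu hv hw h
  rw [lintegral_prod _ hu.aemeasurable, lintegral_prod _ hv.aemeasurable,
    lintegral_prod _ hw.aemeasurable]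
  exact hμ _ _ _ hu.lintegral_prod_right' hv.lintegral_prod_right' hw.lintegral_prod_right'
    fun x x' => hν _ _ _ (hu.comp measurable_prodMk_left) (hv.comp measurable_prodMk_left)
      (hw.comp measurable_prodMk_left) fun y y' => by simpa using h (x, y) (x', y')

theorem PrekopaLeindler.of_measurePreserving (hν : PrekopaLeindler ν) (e : E ≃ᵐ F)
    (he : MeasurePreserving e μ ν)
    (hmid : ∀ x y, e.symm ((2⁻¹ : ℝ) • (x + y)) = (2⁻¹ : ℝ) • (e.symm x + e.symm y)) :
    PrekopaLeindler μ := by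
  intro u v w hu hv hw h
  have key := hν (u ∘ e.symm) (v ∘ e.symm) (w ∘ e.symm) (hu.comp e.symm.measurable)
    (hv.comp e.symm.measurable) (hw.comp e.symm.measurable)
    fun x y => by
      simpa only [Function.comp_apply, hmid] using h (e.symm x) (e.symm y)
  rw [← he.lintegral_comp_emb e.measurableEmbedding, ← he.lintegral_comp_emb e.measurableEmbedding,
    ← he.lintegral_comp_emb e.measurableEmbedding] at key
  simpa using key

end

theorem prekopaLeindler_pi (n : ℕ) : PrekopaLeindler (volume : Measure (Fin n → ℝ)) := by
  induction n with
  | zero =>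
    intro u v w _ _ _ h
    rw [volume_pi, Measure.pi_of_empty _ 0]
    simpa [Subsingleton.elim ((2⁻¹ : ℝ) • (0 + 0) : Fin 0 → ℝ) 0] using h 0 0
  | succ n ih =>
    refine (prekopaLeindler_real.prod ih).of_measurePreserving _
      (volume_preserving_piFinSuccAbove (fun _ => ℝ) 0) fun x y => ?_
    ext i
    refine Fin.cases ?_ (fun j => ?_) i <;> simp [MeasurableEquiv.piFinSuccAbove, mul_add]

theorem prekopaLeindler_euclideanSpace (n : ℕ) :
    PrekopaLeindler (volume : Measure (EuclideanSpace ℝ (Fin n))) :=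
  (prekopaLeindler_pi n).of_measurePreserving (MeasurableEquiv.toLp 2 (Fin n → ℝ)).symm
    (PiLp.volume_preserving_ofLp (Fin n)) fun _ _ => rfl

section

variable {E : Type*} [NormedAddCommGroup E] [InnerProductSpace ℝ E] [CompleteSpace E]

theorem ContDiff.gradient {V : E → ℝ} {m n : WithTop ℕ∞} (hV : ContDiff ℝ n V) (hmn : m + 1 ≤ n) :
    ContDiff ℝ m (gradient V) :=
  (InnerProductSpace.toDual ℝ E).symm.contDiff.comp (hV.fderiv_right hmn)

theorem map_midpoint_le_of_le_inner_fderiv_gradient {V : E → ℝ} {α : ℝ} (hV : ContDiff ℝ 2 V)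
    (hconv : ∀ x v : E, α * ‖v‖ ^ 2 ≤ ⟪fderiv ℝ (gradient V) x v, v⟫) (x y : E) :
    V ((2⁻¹ : ℝ) • (x + y)) ≤ 2⁻¹ * (V x + V y) - α / 8 * ‖x - y‖ ^ 2 := by
  set m : E := (2⁻¹ : ℝ) • (x + y) with hm
  set d : E := (2⁻¹ : ℝ) • (x - y) with hd
  have hline : ∀ t : ℝ, HasDerivAt (fun t : ℝ => m + t • d) d t := fun t => by
    simpa using ((hasDerivAt_id t).smul_const d).const_add m
  have hV1 : ∀ t : ℝ, HasDerivAt (fun t : ℝ => V (m + t • d) - α / 2 * ‖d‖ ^ 2 * t ^ 2)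
      (⟪gradient V (m + t • d), d⟫ - α * ‖d‖ ^ 2 * t) t := fun t => by
    have h1 := (hV.differentiable two_ne_zero (m + t • d)).hasGradientAt.hasFDerivAt.comp_hasDerivAt
      t (hline t)
    have h2 := (hasDerivAt_pow 2 t).const_mul (α / 2 * ‖d‖ ^ 2)
    convert! h1.sub h2 using 1
    simp
    ring
  have hV2 : ∀ t : ℝ, HasDerivAt (fun t : ℝ => ⟪gradient V (m + t • d), d⟫ - α * ‖d‖ ^ 2 * t)
      (⟪fderiv ℝ (gradient V) (m + t • d) d, d⟫ - α * ‖d‖ ^ 2) t := fun t => by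
    have hg : ContDiff ℝ 1 (gradient V) := hV.gradient (by norm_num)
    have h1 := (hg.differentiable one_ne_zero (m + t • d)).hasFDerivAt.comp_hasDerivAt t (hline t)
    have h2 := h1.inner ℝ (hasDerivAt_const t d)
    have h3 := (hasDerivAt_id t).const_mul (α * ‖d‖ ^ 2)
    convert! h2.sub h3 using 1
    simp
  have hconvex : ConvexOn ℝ Set.univ fun t : ℝ => V (m + t • d) - α / 2 * ‖d‖ ^ 2 * t ^ 2 := by
    refine convexOn_of_hasDerivWithinAt2_nonneg convex_univ
      (fun t _ => (hV1 t).continuousAt.continuousWithinAt)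
      (fun t _ => (hV1 t).hasDerivWithinAt) (fun t _ => (hV2 t).hasDerivWithinAt)
      fun t _ => sub_nonneg.2 (hconv _ _)
  have key := hconvex.2 (Set.mem_univ (1 : ℝ)) (Set.mem_univ (-1 : ℝ))
    (by norm_num : (0 : ℝ) ≤ 2⁻¹) (by norm_num : (0 : ℝ) ≤ 2⁻¹) (by norm_num)
  have hx : m + (1 : ℝ) • d = x := by rw [hm, hd]; module
  have hy : m + (-1 : ℝ) • d = y := by rw [hm, hd]; module
  have hnorm : ‖d‖ ^ 2 = ‖x - y‖ ^ 2 / 4 := by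
    rw [hd, norm_smul, mul_pow]
    norm_num
    ring
  simp only [hx, hy, hnorm, smul_eq_mul] at key
  norm_num at key
  linarith

theorem exists_sub_le_norm_gradient_mul_add {f : E → ℝ} (hf : ContDiff ℝ 2 f)
    (hf' : HasCompactSupport f) : ∃ K : ℝ, 0 ≤ K ∧ ∀ x y : E,
      f x - f y ≤ ‖gradient f x‖ * ‖x - y‖ + K * ‖x - y‖ ^ 2 := by
  obtain ⟨K, hK⟩ := ContDiff.lipschitzWith_of_hasCompactSupport (hf'.fderiv ℝ)
    (hf.fderiv_right (m := 1) (by norm_num)) one_ne_zero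
  refine ⟨K, K.2, fun x y => ?_⟩
  have hbound : ∀ z ∈ segment ℝ x y, ‖fderiv ℝ f z - fderiv ℝ f x‖ ≤ K * ‖y - x‖ := by
    intro z hz
    refine (hK.norm_sub_le z x).trans ?_
    gcongr
    simpa using norm_sub_le_of_mem_segment hz
  have h1 := (convex_segment x y).norm_image_sub_le_of_norm_fderiv_le'
    (fun z _ => hf.differentiable two_ne_zero z) hbound (left_mem_segment ℝ x y)
    (right_mem_segment ℝ x y)
  have h2 : ‖gradient f x‖ = ‖fderiv ℝ f x‖ := by simp [gradient]
  have h3 := (fderiv ℝ f x).le_opNorm (y - x)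
  rw [Real.norm_eq_abs] at h1 h3
  rw [h2, norm_sub_rev x y]
  have h4 := neg_abs_le (f y - f x - fderiv ℝ f x (y - x))
  have h5 := neg_abs_le (fderiv ℝ f x (y - x))
  nlinarith

end

theorem le_exp_mul_sub_sq_mul {f h M ε : ℝ} (hM : 1 ≤ M) (hf : |f| ≤ M) (hh : |h| ≤ M)
    (hε : 0 ≤ ε) (hεM : 2 * ε * M ≤ 1) :
    1 + ε * f + ε ^ 2 * (f ^ 2 / 2 - h) - 9 * M ^ 3 * ε ^ 3 ≤ Real.exp (ε * f - ε ^ 2 * h) := by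
  set s := ε * f - ε ^ 2 * h with hs
  have hε1 : ε ≤ 1 := by nlinarith
  have hsM : |s| ≤ 2 * ε * M := by
    calc |s| ≤ |ε * f| + |ε ^ 2 * h| := abs_sub _ _
      _ = ε * |f| + ε ^ 2 * |h| := by
          rw [abs_mul, abs_mul, abs_of_nonneg hε, abs_of_nonneg (sq_nonneg ε)]
      _ ≤ ε * M + ε * M := by
          gcongr
          nlinarith
      _ = _ := by ring
  have hexp := Real.exp_bound (hsM.trans hεM) (n := 3) (by norm_num)
  have h1 := neg_le_of_abs_le hexp
  have h2 : |s| ^ 3 ≤ 8 * M ^ 3 * ε ^ 3 := by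
    calc |s| ^ 3 ≤ (2 * ε * M) ^ 3 := by gcongr
      _ = _ := by ring
  have h3 : f * h ≤ M ^ 3 := by
    calc f * h ≤ |f| * |h| := by rw [← abs_mul]; exact le_abs_self _
      _ ≤ M * M := by gcongr
      _ = M ^ 2 := by ring
      _ ≤ M ^ 3 := pow_le_pow_right₀ hM (by norm_num)
  have h4 : ε ^ 3 * (f * h) ≤ ε ^ 3 * M ^ 3 := by gcongr
  have h5 : s ^ 2 = ε ^ 2 * f ^ 2 - 2 * ε ^ 3 * (f * h) + (ε ^ 2 * h) ^ 2 := by rw [hs]; ring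
  have h6 : 0 ≤ |s| ^ 3 := by positivity
  norm_num [Finset.sum_range_succ, Nat.factorial] at h1
  nlinarith [sq_nonneg (ε ^ 2 * h)]

open Filter Topology in
theorem integral_sq_sub_sq_integral_le_of_eventually {Ω : Type*} [MeasurableSpace Ω]
    {μ : Measure Ω} [IsProbabilityMeasure μ] {f h : Ω → ℝ} (hf : Measurable f) (hh : Measurable h)
    {M : ℝ} (hfM : ∀ x, |f x| ≤ M) (hhM : ∀ x, |h x| ≤ M)
    (H : ∀ᶠ ε in 𝓝[>] (0 : ℝ),
      (∫ x, Real.exp (ε * f x - ε ^ 2 * h x) ∂μ) * ∫ x, Real.exp (-ε * f x) ∂μ ≤ 1) :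
    (∫ x, (f x) ^ 2 ∂μ) - (∫ x, f x ∂μ) ^ 2 ≤ ∫ x, h x ∂μ := by
  wlog hM : 1 ≤ M generalizing M
  · exact this (fun x => (hfM x).trans (le_max_left M 1)) (fun x => (hhM x).trans (le_max_left M 1))
      (le_max_right M 1)
  have lower : ∀ g k : Ω → ℝ, Measurable g → Measurable k → (∀ x, |g x| ≤ M) → (∀ x, |k x| ≤ M) →
      ∀ ε : ℝ, 0 ≤ ε → 2 * ε * M ≤ 1 →
      1 + ε * (∫ x, g x ∂μ) + ε ^ 2 * ((∫ x, (g x) ^ 2 ∂μ) / 2 - ∫ x, k x ∂μ) - 9 * M ^ 3 * ε ^ 3 ≤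
        ∫ x, Real.exp (ε * g x - ε ^ 2 * k x) ∂μ := by
    intro g k hg hk hgM hkM ε hε hεM
    have ig : Integrable g μ := .of_bound hg.aestronglyMeasurable M (ae_of_all _ hgM)
    have ik : Integrable k μ := .of_bound hk.aestronglyMeasurable M (ae_of_all _ hkM)
    have ig2 : Integrable (fun x => (g x) ^ 2) μ := by
      refine .of_bound (hg.pow_const 2).aestronglyMeasurable (M ^ 2) (ae_of_all _ fun x => ?_)
      rw [norm_pow, Real.norm_eq_abs]
      gcongr
      exact hgM x
    have iexp : Integrable (fun x => Real.exp (ε * g x - ε ^ 2 * k x)) μ := by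
      refine .of_bound (by fun_prop) (Real.exp (ε * M + ε ^ 2 * M)) (ae_of_all _ fun x => ?_)
      rw [Real.norm_eq_abs, Real.abs_exp, sub_eq_add_neg, ← mul_neg]
      gcongr
      · exact (le_abs_self _).trans (hgM x)
      · exact (neg_le_abs _).trans (hkM x)
    have i1 : Integrable (fun x => 1 + ε * g x) μ := (integrable_const 1).add (ig.const_mul ε)
    have i2 : Integrable (fun x => (g x) ^ 2 / 2 - k x) μ := (ig2.div_const 2).sub ik
    have i3 : Integrable (fun x => 1 + ε * g x + ε ^ 2 * ((g x) ^ 2 / 2 - k x)) μ :=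
      i1.add (i2.const_mul _)
    have key := integral_mono (i3.sub (integrable_const (9 * M ^ 3 * ε ^ 3))) iexp fun x =>
      le_exp_mul_sub_sq_mul hM (hgM x) (hkM x) hε hεM
    simp only [Pi.sub_apply] at key
    rw [integral_sub i3 (integrable_const _), integral_add i1 (i2.const_mul _),
      integral_add (integrable_const _) (ig.const_mul ε), integral_const_mul, integral_const_mul,
      integral_sub (ig2.div_const 2) ik, integral_div] at key
    simpa using key
  set a := ∫ x, f x ∂μ
  set b := ∫ x, (f x) ^ 2 ∂μ
  set c := ∫ x, h x ∂μ
  set C := 9 * M ^ 3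
  have hp : Tendsto (fun ε : ℝ => 1 + ε * a + ε ^ 2 * (b / 2 - c) - C * ε ^ 3) (𝓝[>] 0) (𝓝 1) := by
    refine ((Continuous.tendsto' (by fun_prop) 0 1 ?_)).mono_left nhdsWithin_le_nhds
    simp
  have hq : Tendsto (fun ε : ℝ => 1 - ε * a + ε ^ 2 * (b / 2) - C * ε ^ 3) (𝓝[>] 0) (𝓝 1) := by
    refine ((Continuous.tendsto' (by fun_prop) 0 1 ?_)).mono_left nhdsWithin_le_nhds
    simp
  have hεM : ∀ᶠ ε : ℝ in 𝓝[>] 0, 2 * ε * M < 1 := by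
    have : Tendsto (fun ε : ℝ => 2 * ε * M) (𝓝[>] 0) (𝓝 0) := by
      refine ((Continuous.tendsto' (by fun_prop) 0 0 ?_)).mono_left nhdsWithin_le_nhds
      simp
    exact this.eventually_lt_const one_pos
  have hlim : Tendsto (fun ε : ℝ => b - a ^ 2 - c + ε * (-2 * C + a * c +
      ε * ((b / 2 - c) * (b / 2)) - ε ^ 2 * C * (b - c) + C ^ 2 * ε ^ 3)) (𝓝[>] 0)
      (𝓝 (b - a ^ 2 - c)) := by
    refine ((Continuous.tendsto' (by fun_prop) 0 _ ?_)).mono_left nhdsWithin_le_nhds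
    simp
  have hle : b - a ^ 2 - c ≤ 0 := by
    refine le_of_tendsto hlim ?_
    filter_upwards [H, hp.eventually_const_lt one_pos, hq.eventually_const_lt one_pos, hεM,
      self_mem_nhdsWithin] with ε hH hp0 hq0 hε1 hε
    have hε0 : 0 < ε := hε
    have h1 := lower f h hf hh hfM hhM ε hε0.le hε1.le
    have h2 := lower (fun x => -f x) (fun _ => 0) hf.neg measurable_const (by simpa using hfM)
      (fun _ => by simpa using zero_le_one.trans hM) ε hε0.le hε1.le
    simp only [integral_neg, neg_sq, integral_zero, sub_zero, mul_zero, mul_neg, ← sub_eq_add_neg]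
      at h2
    simp only [neg_mul] at hH
    have h3 := (mul_le_mul h1 h2 hq0.le (hp0.le.trans h1)).trans hH
    refine nonpos_of_mul_nonpos_right (b := _) (a := ε ^ 2) ?_ (by positivity)
    nlinarith
  linarith

theorem integral_exp_mul_integral_exp_neg_le_one {n : ℕ} {V : EuclideanSpace ℝ (Fin n) → ℝ}
    (hV : Measurable V) {μ : Measure (EuclideanSpace ℝ (Fin n))}
    (hμ : μ = volume.withDensity (fun x => ENNReal.ofReal (Real.exp (-V x))))
    [IsProbabilityMeasure μ] {u v : EuclideanSpace ℝ (Fin n) → ℝ} (hu : Measurable u)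
    (hv : Measurable v)
    (h : ∀ x y, u x + v y + 2 * V ((2⁻¹ : ℝ) • (x + y)) ≤ V x + V y) :
    (∫ x, Real.exp (u x) ∂μ) * ∫ x, Real.exp (v x) ∂μ ≤ 1 := by
  have hdens : ∀ k : EuclideanSpace ℝ (Fin n) → ℝ, Measurable k →
      ∫⁻ x, ENNReal.ofReal (Real.exp (k x)) ∂μ = ∫⁻ x, ENNReal.ofReal (Real.exp (k x - V x)) := by
    intro k hk
    rw [hμ, lintegral_withDensity_eq_lintegral_mul _ (by fun_prop) (by fun_prop)]
    refine lintegral_congr fun x => ?_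
    rw [Pi.mul_apply, ← ENNReal.ofReal_mul (Real.exp_pos _).le, ← Real.exp_add]
    ring_nf
  have key := prekopaLeindler_euclideanSpace n (fun x => ENNReal.ofReal (Real.exp (u x - V x)))
    (fun x => ENNReal.ofReal (Real.exp (v x - V x)))
    (fun x => ENNReal.ofReal (Real.exp (0 - V x))) (by fun_prop) (by fun_prop) (by fun_prop)
    fun x y => by
      rw [← ENNReal.ofReal_mul (Real.exp_pos _).le, ← Real.exp_add,
        ← ENNReal.ofReal_pow (Real.exp_pos _).le, ← Real.exp_nat_mul]
      refine ENNReal.ofReal_le_ofReal (Real.exp_le_exp.2 ?_)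
      push_cast
      linarith [h x y]
  rw [← hdens u hu, ← hdens v hv, ← hdens (fun _ => 0) measurable_const] at key
  simp only [Real.exp_zero, ENNReal.ofReal_one, lintegral_one, measure_univ, one_pow] at key
  rw [integral_eq_lintegral_of_nonneg_ae (ae_of_all _ fun x => (Real.exp_pos _).le)
      (by fun_prop), integral_eq_lintegral_of_nonneg_ae (ae_of_all _ fun x => (Real.exp_pos _).le)
      (by fun_prop), ← ENNReal.toReal_mul]
  exact ENNReal.toReal_le_of_le_ofReal zero_le_one (by simpa using key)

open Filter Topology in
/-- Lichnerowicz estimate: if `∇²V ≥ α Id` with `α > 0` then the measure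
`e^{-V} dx` satisfies the Poincaré inequality with constant `1/α`. -/
theorem lichnerowicz_poincare
    (n : ℕ) (V : EuclideanSpace ℝ (Fin n) → ℝ) (α : ℝ) (hα : 0 < α)
    (hV : ContDiff ℝ 2 V)
    (μ : Measure (EuclideanSpace ℝ (Fin n)))
    (hμ : μ = volume.withDensity (fun x => ENNReal.ofReal (Real.exp (-V x))))
    [IsProbabilityMeasure μ]
    (hconv : ∀ x v : EuclideanSpace ℝ (Fin n),
      α * ‖v‖ ^ 2 ≤ ⟪fderiv ℝ (gradient V) x v, v⟫) :
    ∀ f : EuclideanSpace ℝ (Fin n) → ℝ, ContDiff ℝ (⊤ : ℕ∞) f → HasCompactSupport f →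
      (∫ x, (f x) ^ 2 ∂μ) - (∫ x, f x ∂μ) ^ 2 ≤
        (1 / α) * ∫ x, ‖gradient f x‖ ^ 2 ∂μ := by
  intro f hf hfc
  have hf2 : ContDiff ℝ 2 f := hf.of_le (WithTop.coe_le_coe.2 (le_top : (2 : ℕ∞) ≤ ⊤))
  have hfm : Measurable f := hf.continuous.measurable
  have hgrad : Continuous (gradient f) := (hf2.gradient (m := 1) (by norm_num)).continuous
  obtain ⟨K, hK, hfK⟩ := exists_sub_le_norm_gradient_mul_add hf2 hfc
  obtain ⟨M₁, hM₁⟩ := hfc.exists_bound_of_continuous hf.continuous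
  obtain ⟨M₂, hM₂⟩ := (hfc.fderiv ℝ).exists_bound_of_continuous
    (hf2.continuous_fderiv two_ne_zero)
  have hgradM : ∀ x, ‖gradient f x‖ ≤ M₂ := fun x => by simpa [gradient] using hM₂ x
  have main : ∀ β, 0 < β → β < α → (∫ x, (f x) ^ 2 ∂μ) - (∫ x, f x ∂μ) ^ 2 ≤
      (1 / β) * ∫ x, ‖gradient f x‖ ^ 2 ∂μ := by
    intro β hβ hβα
    rw [← integral_const_mul]
    refine integral_sq_sub_sq_integral_le_of_eventually (M := max M₁ (1 / β * M₂ ^ 2))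
      hfm (by fun_prop) (fun x => (hM₁ x).trans (le_max_left _ _))
      (fun x => ?_) ?_
    · rw [abs_of_nonneg (by positivity)]
      refine le_trans ?_ (le_max_right _ _)
      gcongr
      exact hgradM x
    · have hsmall : ∀ᶠ ε : ℝ in 𝓝[>] 0, ε * K < (α - β) / 4 := by
        have : Tendsto (fun ε : ℝ => ε * K) (𝓝[>] 0) (𝓝 0) := by
          refine ((Continuous.tendsto' (by fun_prop) 0 0 ?_)).mono_left nhdsWithin_le_nhds
          simp
        exact this.eventually_lt_const (by linarith)
      filter_upwards [hsmall, self_mem_nhdsWithin] with ε hεK hε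
      have hε0 : 0 < ε := hε
      refine integral_exp_mul_integral_exp_neg_le_one hV.continuous.measurable hμ
        (by fun_prop) (by fun_prop) fun x y => ?_
      have h1 := map_midpoint_le_of_le_inner_fderiv_gradient hV hconv x y
      have h2 := mul_le_mul_of_nonneg_left (hfK x y) hε0.le
      have h3 : ε * ‖gradient f x‖ * ‖x - y‖ ≤
          ε ^ 2 * (1 / β * ‖gradient f x‖ ^ 2) + β / 4 * ‖x - y‖ ^ 2 := by
        have h4 : ε ^ 2 * (1 / β * ‖gradient f x‖ ^ 2) + β / 4 * ‖x - y‖ ^ 2 -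
            ε * ‖gradient f x‖ * ‖x - y‖ =
            1 / β * (ε * ‖gradient f x‖ - β / 2 * ‖x - y‖) ^ 2 := by
          field_simp
          ring
        have : 0 ≤ 1 / β * (ε * ‖gradient f x‖ - β / 2 * ‖x - y‖) ^ 2 := by positivity
        linarith
      have h5 := mul_le_mul_of_nonneg_right hεK.le (sq_nonneg ‖x - y‖)
      nlinarith
  have hlim : Tendsto (fun β : ℝ => (1 / β) * ∫ x, ‖gradient f x‖ ^ 2 ∂μ) (𝓝[<] α)
      (𝓝 ((1 / α) * ∫ x, ‖gradient f x‖ ^ 2 ∂μ)) := by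
    refine Tendsto.mono_left ?_ nhdsWithin_le_nhds
    exact (tendsto_const_nhds.div tendsto_id hα.ne').mul_const _
  refine ge_of_tendsto hlim ?_
  filter_upwards [Ioo_mem_nhdsLT hα] with β hβ
  exact main β hβ.1 hβ.2
end

section
/- Let H be a Hilbert space and B a self-adjoint operator on H whose spectrum is contained in [1, ∞). Then for every g ∈ H and every positive integer n, ⟨n⁶(n⁴·Id + B²)^{−2} g, g⟩ ≤ C ⟨B(n⁴·Id + B²)^{−1} g, g⟩ summed over odd n: namely ∑_{n odd} n⁶(n⁴+B²)^{−2} ≤ C ∑_{n odd} B(n⁴+B²)^{−1} as positive operators, for a universal constant C. -/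
open RealInnerProductSpace

section

variable {H : Type*} [NormedAddCommGroup H] [InnerProductSpace ℝ H] [CompleteSpace H]

lemma IsSelfAdjoint.real_inner_apply {B : H →L[ℝ] H} (hB : IsSelfAdjoint B) (x y : H) :
    ⟪B x, y⟫ = ⟪x, B y⟫ := by
  have h := ContinuousLinearMap.adjoint_inner_left B y x
  rwa [hB.adjoint_eq] at h

/-- A form of the Cauchy-Schwarz inequality for nonnegative self-adjoint operators. -/
lemma IsSelfAdjoint.norm_sq_apply_le {A : H →L[ℝ] H} (hA : IsSelfAdjoint A)
    (hpos : ∀ x, 0 ≤ ⟪A x, x⟫) (x : H) : ‖A x‖ ^ 2 ≤ (‖A‖ + 1) * ⟪A x, x⟫ := by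
  have hM : 0 < ‖A‖ + 1 := by positivity
  set M := ‖A‖ + 1 with hMdef
  have h1 := hpos (M • x - A x)
  have h2 : ⟪A (A x), A x⟫ ≤ M * ‖A x‖ ^ 2 := by
    calc ⟪A (A x), A x⟫ ≤ ‖A (A x)‖ * ‖A x‖ := real_inner_le_norm _ _
      _ ≤ (‖A‖ * ‖A x‖) * ‖A x‖ := by gcongr; exact A.le_opNorm _
      _ ≤ M * ‖A x‖ ^ 2 := by rw [hMdef]; nlinarith [sq_nonneg ‖A x‖]
  have h3 : ⟪A (A x), x⟫ = ‖A x‖ ^ 2 := by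
    rw [hA.real_inner_apply, real_inner_self_eq_norm_sq]
  simp only [map_sub, map_smul, inner_sub_left, inner_sub_right, real_inner_smul_left,
    real_inner_smul_right, h3, real_inner_self_eq_norm_sq] at h1
  have h4 : 0 ≤ M * (M * ⟪A x, x⟫ - ‖A x‖ ^ 2) := by linarith
  linarith [nonneg_of_mul_nonneg_right h4 hM]

/-- A self-adjoint operator with spectrum in `[c, ∞)` is bounded below by `c`. -/
lemma IsSelfAdjoint.mul_norm_sq_le_inner_of_spectrum_subset {B : H →L[ℝ] H}
    (hB : IsSelfAdjoint B) {c : ℝ} (hs : spectrum ℝ B ⊆ Set.Ici c) (x : H) :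
    c * ‖x‖ ^ 2 ≤ ⟪B x, x⟫ := by
  rcases eq_or_ne x 0 with rfl | hx
  · simp
  set T : Set ℝ := {t | ∀ y, t * ‖y‖ ^ 2 ≤ ⟪B y, y⟫} with hT
  have hxpos : 0 < ‖x‖ ^ 2 := by positivity
  have hbdd : BddAbove T := ⟨⟪B x, x⟫ / ‖x‖ ^ 2, fun t ht ↦ (le_div_iff₀ hxpos).2 (ht x)⟩
  have hne : T.Nonempty := by
    refine ⟨-‖B‖, fun y ↦ ?_⟩
    have h1 := (abs_le.1 (abs_real_inner_le_norm (B y) y)).1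
    have h2 : ‖B y‖ * ‖y‖ ≤ (‖B‖ * ‖y‖) * ‖y‖ := by gcongr; exact B.le_opNorm _
    nlinarith
  have hclosed : IsClosed T := by
    simp only [hT, Set.ofPred_forall]
    exact isClosed_iInter fun y ↦ isClosed_le (by fun_prop) continuous_const
  have hm : sSup T ∈ T := hclosed.csSup_mem hne hbdd
  set m := sSup T with hmdef
  by_cases hc : c ≤ m
  · exact (mul_le_mul_of_nonneg_right hc hxpos.le).trans (hm x)
  exfalso
  have hunit : IsUnit (algebraMap ℝ (H →L[ℝ] H) m - B) := by
    by_contra h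
    exact hc (hs h)
  obtain ⟨V, hV⟩ := hunit.exists_left_inv
  set A : H →L[ℝ] H := B - algebraMap ℝ (H →L[ℝ] H) m with hAdef
  have hAx (y : H) : A y = B y - m • y := by simp [hAdef, Algebra.algebraMap_eq_smul_one]
  have hAsa : IsSelfAdjoint A := hB.sub (IsSelfAdjoint.algebraMap _ (IsSelfAdjoint.all m))
  have hAin (y : H) : ⟪A y, y⟫ = ⟪B y, y⟫ - m * ‖y‖ ^ 2 := by
    rw [hAx, inner_sub_left, real_inner_smul_left, real_inner_self_eq_norm_sq]
  have hApos (y : H) : 0 ≤ ⟪A y, y⟫ := by rw [hAin]; linarith [hm y]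
  have hVy (y : H) : ‖y‖ ≤ (‖V‖ + 1) * ‖A y‖ := by
    have h1 : V (-(A y)) = y := by
      have := congrArg (fun L : H →L[ℝ] H ↦ L y) hV
      simpa [hAdef] using this
    calc ‖y‖ = ‖V (-(A y))‖ := by rw [h1]
      _ ≤ ‖V‖ * ‖A y‖ := by simpa using V.le_opNorm (-(A y))
      _ ≤ (‖V‖ + 1) * ‖A y‖ := by gcongr; linarith
  have hK : 0 < (‖V‖ + 1) ^ 2 * (‖A‖ + 1) := by positivity
  set K := (‖V‖ + 1) ^ 2 * (‖A‖ + 1) with hKdef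
  have hmem : m + 1 / K ∈ T := by
    intro y
    have h1 : ‖y‖ ^ 2 ≤ K * ⟪A y, y⟫ := by
      calc ‖y‖ ^ 2 ≤ ((‖V‖ + 1) * ‖A y‖) ^ 2 := by gcongr; exact hVy y
        _ = (‖V‖ + 1) ^ 2 * ‖A y‖ ^ 2 := by ring
        _ ≤ (‖V‖ + 1) ^ 2 * ((‖A‖ + 1) * ⟪A y, y⟫) := by
          gcongr; exact hAsa.norm_sq_apply_le hApos y
        _ = K * ⟪A y, y⟫ := by rw [hKdef]; ring
    have h2 : 1 / K * ‖y‖ ^ 2 ≤ ⟪A y, y⟫ := by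
      rw [one_div, inv_mul_le_iff₀ hK]; exact h1
    rw [hAin] at h2
    linarith
  have := le_csSup hbdd hmem
  have : 0 < 1 / K := by positivity
  linarith

/-- The telescoping estimate behind the comparison of the two resolvent sums: `S` and `T` are the
inverses of `n ^ 4 + B ^ 2` and `(n + 2) ^ 4 + B ^ 2`. -/
lemma resolvent_telescoping {B S T : H →L[ℝ] H} (hB : IsSelfAdjoint B)
    (hpos : ∀ x, 0 ≤ ⟪B x, x⟫) {n : ℝ} (hn : 1 ≤ n)
    (hS : (n ^ 4 • (1 : H →L[ℝ] H) + B ^ 2) * S = 1)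
    (hT : T * ((n + 2) ^ 4 • (1 : H →L[ℝ] H) + B ^ 2) = 1)
    (hT' : ((n + 2) ^ 4 • (1 : H →L[ℝ] H) + B ^ 2) * T = 1) (g : H) :
    n ^ 6 * ⟪(S ^ 2) g, g⟫ ≤ 81 / 2 *
      (n ^ 3 * ⟪S g, g⟫ - (n + 2) ^ 3 * ⟪T g, g⟫ + 13 * ⟪(B * S) g, g⟫) := by
  set c := n ^ 4 with hc
  set d := (n + 2) ^ 4 with hd
  obtain ⟨h, hh⟩ : ∃ h, h = T (S g) := ⟨_, rfl⟩
  have hSb : S g = B (B h) + d • h := by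
    have := congrArg (fun L : H →L[ℝ] H ↦ L (S g)) hT'
    simp [pow_two, ← hh] at this
    rw [← this]; abel
  have hg : g = B (B (B (B h))) + (c + d) • B (B h) + (c * d) • h := by
    have := congrArg (fun L : H →L[ℝ] H ↦ L g) hS
    simp [pow_two, hSb] at this
    rw [← this]; module
  have hTa : T g = B (B h) + c • h := by
    have := congrArg (fun L : H →L[ℝ] H ↦ L (B (B h) + c • h)) hT
    simp [pow_two] at this
    rw [← this, hg, ← map_smul T, ← map_smul T, ← map_smul T, ← map_smul T, ← map_add T,
      ← map_add T, ← map_add T]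
    congr 1
    module
  have hSS : ⟪(S ^ 2) g, g⟫ = ⟪S g, S g⟫ := by
    have hb := congrArg (fun L : H →L[ℝ] H ↦ L (S g)) hS
    have hgS := congrArg (fun L : H →L[ℝ] H ↦ L g) hS
    simp [pow_two] at hb hgS
    calc ⟪(S ^ 2) g, g⟫ = ⟪S (S g), c • S g + B (B (S g))⟫ := by
          rw [hgS, pow_two, mul_apply_eq_comp]
      _ = ⟪c • S (S g) + B (B (S (S g))), S g⟫ := by
          simp only [inner_add_left, inner_add_right, real_inner_smul_left, real_inner_smul_right,
            hB.real_inner_apply]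
      _ = ⟪S g, S g⟫ := by rw [hb]
  rw [hSS, mul_apply_eq_comp, hSb, hTa, hg]
  have e0 : 0 ≤ ⟪h, h⟫ := real_inner_self_nonneg
  have e2 : 0 ≤ ⟪B h, B h⟫ := real_inner_self_nonneg
  have e4 : 0 ≤ ⟪B (B h), B (B h)⟫ := real_inner_self_nonneg
  have o1 := hpos h
  have o3 := hpos (B h)
  have o5 := hpos (B (B h))
  obtain ⟨s, hs⟩ : ∃ s, s = (3 * n ^ 2 + 6 * n + 4) / 13 := ⟨_, rfl⟩
  have q1 := hpos (B h - s • h)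
  have q3 := hpos (B (B h) - s • B h)
  have q5 := hpos (B (B (B h)) - s • B (B h))
  simp only [map_add, map_sub, map_smul, inner_add_left, inner_add_right, inner_sub_left,
    inner_sub_right, real_inner_smul_left, real_inner_smul_right, hB.real_inner_apply]
    at e0 e2 e4 o1 o3 o5 q1 q3 q5 ⊢
  have hc0 : 0 ≤ c := by positivity
  have hd0 : 0 ≤ d := by positivity
  have hdc : d ≤ 81 * c := by
    calc d ≤ (3 * n) ^ 4 := by rw [hd]; gcongr; linarith
      _ = 81 * c := by rw [hc]; ring
  have hN : n ^ 6 ≤ n ^ 3 * (n + 2) ^ 3 := by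
    calc n ^ 6 = n ^ 3 * n ^ 3 := by ring
      _ ≤ n ^ 3 * (n + 2) ^ 3 := by gcongr; linarith
  have hα : 0 ≤ 81 * (n ^ 3 * (n + 2) ^ 3) * c - n ^ 6 * d := by
    have : n ^ 6 * d ≤ (n ^ 3 * (n + 2) ^ 3) * (81 * c) := by gcongr
    linarith
  have hβ : 0 ≤ 81 * (n ^ 3 * (n + 2) ^ 3) - n ^ 6 := by
    have : 0 ≤ n ^ 6 := by positivity
    linarith
  have hγ : 0 ≤ d - s ^ 2 := by
    have : s ≤ (n + 2) ^ 2 := by rw [hs]; nlinarith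
    have hs0 : 0 ≤ s := by rw [hs]; positivity
    calc (0 : ℝ) ≤ ((n + 2) ^ 2) ^ 2 - s ^ 2 := sub_nonneg.2 (by gcongr)
      _ = d - s ^ 2 := by rw [hd]; ring
  have r0 := mul_nonneg (mul_nonneg hd0 hα) e0
  have r2 := mul_nonneg (add_nonneg hα (mul_nonneg hd0 hβ)) e2
  have r4 := mul_nonneg hβ e4
  have t := mul_nonneg hγ (add_nonneg (add_nonneg o5 (mul_nonneg (add_nonneg hc0 hd0) o3))
    (mul_nonneg (mul_nonneg hc0 hd0) o1))
  have u := add_nonneg (add_nonneg q5 (mul_nonneg (add_nonneg hc0 hd0) q3))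
    (mul_nonneg (mul_nonneg hc0 hd0) q1)
  have hq : (n + 2) ^ 3 - n ^ 3 = 26 * s := by rw [hs]; ring
  have hq' : (n + 2) ^ 3 = n ^ 3 + 26 * s := by linarith
  have hE : n ^ 3 * d = (n + 2) ^ 3 * (c + 2 * n ^ 3) := by rw [hc, hd]; ring
  rw [hq'] at r0 r2 r4 hE ⊢
  clear_value c d
  rw [← sub_nonneg]
  refine (add_nonneg (add_nonneg (add_nonneg r0 r2) r4)
    (mul_nonneg (by norm_num : (0 : ℝ) ≤ 1053 / 2) (add_nonneg t u))).trans_eq ?_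
  linear_combination (-81 / 2) * (⟪h, B (B (B (B h)))⟫ + (c + d) * ⟪h, B (B h)⟫
    + c * d * ⟪h, h⟫) * hE

end

/-- Operator form of the spectral inequality: if `B` is self-adjoint with
spectrum in `[1, ∞)`, then `∑_{n odd} n⁶ (n⁴ + B²)^{-2} ≤ C ∑_{n odd} B (n⁴ + B²)^{-1}`
as positive operators, for a universal constant `C`. The resolvents are given
by the family `R`, where `R k` inverts `(2k+1)⁴ + B²`. -/
theorem operator_spectral_inequality :
    ∃ C : ℝ, 0 < C ∧
    ∀ {H : Type} [NormedAddCommGroup H] [InnerProductSpace ℝ H] [CompleteSpace H]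
      (B : H →L[ℝ] H), IsSelfAdjoint B → spectrum ℝ B ⊆ Set.Ici 1 →
    ∀ R : ℕ → (H →L[ℝ] H),
      (∀ k : ℕ, (((2 * (k : ℝ) + 1) ^ 4) • (1 : H →L[ℝ] H) + B ^ 2) * R k = 1 ∧
        R k * (((2 * (k : ℝ) + 1) ^ 4) • (1 : H →L[ℝ] H) + B ^ 2) = 1) →
    ∀ g : H,
      (∑' k : ℕ, ((2 * (k : ℝ) + 1) ^ 6 * ⟪((R k) ^ 2) g, g⟫)) ≤
        C * ∑' k : ℕ, ⟪(B * R k) g, g⟫ := by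
  refine ⟨567, by norm_num, fun {H} _ _ _ B hB hs R hR g ↦ ?_⟩
  have hle (x : H) : ‖x‖ ^ 2 ≤ ⟪B x, x⟫ := by
    simpa using hB.mul_norm_sq_le_inner_of_spectrum_subset hs x
  have hpos (x : H) : 0 ≤ ⟪B x, x⟫ := (sq_nonneg _).trans (hle x)
  have hn (k : ℕ) : (1 : ℝ) ≤ 2 * k + 1 := by
    have : (0 : ℝ) ≤ k := k.cast_nonneg
    linarith
  have hg (k : ℕ) : (2 * (k : ℝ) + 1) ^ 4 • R k g + B (B (R k g)) = g := by
    simpa [pow_two] using congrArg (fun L : H →L[ℝ] H ↦ L g) (hR k).1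
  have hRg (k : ℕ) : ⟪R k g, g⟫ = (2 * (k : ℝ) + 1) ^ 4 * ‖R k g‖ ^ 2 + ‖B (R k g)‖ ^ 2 := by
    have : ⟪R k g, (2 * (k : ℝ) + 1) ^ 4 • R k g + B (B (R k g))⟫
        = (2 * (k : ℝ) + 1) ^ 4 * ‖R k g‖ ^ 2 + ‖B (R k g)‖ ^ 2 := by
      rw [inner_add_right, real_inner_smul_right, real_inner_self_eq_norm_sq,
        ← hB.real_inner_apply, real_inner_self_eq_norm_sq]
    rwa [hg k] at this
  have hBRg (k : ℕ) : ⟪(B * R k) g, g⟫ =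
      (2 * (k : ℝ) + 1) ^ 4 * ⟪B (R k g), R k g⟫ + ⟪B (B (R k g)), B (R k g)⟫ := by
    have : ⟪B (R k g), (2 * (k : ℝ) + 1) ^ 4 • R k g + B (B (R k g))⟫
        = (2 * (k : ℝ) + 1) ^ 4 * ⟪B (R k g), R k g⟫ + ⟪B (B (R k g)), B (R k g)⟫ := by
      rw [inner_add_right, real_inner_smul_right, ← hB.real_inner_apply (B (R k g))]
    rwa [hg k] at this
  have hφ (k : ℕ) : 0 ≤ ⟪R k g, g⟫ := by rw [hRg]; positivity
  have hψ (k : ℕ) : 0 ≤ ⟪(B * R k) g, g⟫ := by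
    rw [hBRg]
    exact add_nonneg (mul_nonneg (by positivity) (hpos _)) (hpos _)
  have hφψ (k : ℕ) : ⟪R k g, g⟫ ≤ ⟪(B * R k) g, g⟫ := by
    rw [hRg, hBRg]
    gcongr
    · exact hle _
    · exact hle _
  have hsum : Summable fun k : ℕ ↦ ⟪(B * R k) g, g⟫ := by
    have hs4 : Summable fun k : ℕ ↦ ‖B‖ * ‖g‖ ^ 2 * (1 / ((k + 1 : ℕ) : ℝ) ^ 4) :=
      ((summable_nat_add_iff 1).2 (Real.summable_one_div_nat_pow.2 (by norm_num))).mul_left _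
    refine Summable.of_nonneg_of_le hψ (fun k ↦ ?_) hs4
    have h1 : ((k + 1 : ℕ) : ℝ) ^ 4 ≤ (2 * (k : ℝ) + 1) ^ 4 := by
      gcongr
      push_cast
      linarith [(k.cast_nonneg : (0 : ℝ) ≤ k)]
    have h2 : ((k + 1 : ℕ) : ℝ) ^ 4 * ‖R k g‖ ≤ ‖g‖ := by
      rcases (norm_nonneg (R k g)).eq_or_lt with h0 | h0
      · simp [← h0]
      · refine le_of_mul_le_mul_right ?_ h0
        calc ((k + 1 : ℕ) : ℝ) ^ 4 * ‖R k g‖ * ‖R k g‖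
            = ((k + 1 : ℕ) : ℝ) ^ 4 * ‖R k g‖ ^ 2 := by ring
          _ ≤ (2 * (k : ℝ) + 1) ^ 4 * ‖R k g‖ ^ 2 := by gcongr
          _ ≤ ⟪R k g, g⟫ := by rw [hRg]; linarith [sq_nonneg ‖B (R k g)‖]
          _ ≤ ‖g‖ * ‖R k g‖ := by rw [mul_comm]; exact real_inner_le_norm _ _
    have hk : 0 < ((k + 1 : ℕ) : ℝ) ^ 4 := by positivity
    calc ⟪(B * R k) g, g⟫ ≤ ‖B (R k g)‖ * ‖g‖ := real_inner_le_norm _ _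
      _ ≤ (‖B‖ * ‖R k g‖) * ‖g‖ := by gcongr; exact B.le_opNorm _
      _ ≤ (‖B‖ * (‖g‖ / ((k + 1 : ℕ) : ℝ) ^ 4)) * ‖g‖ := by
        gcongr
        rw [le_div_iff₀ hk, mul_comm]
        exact h2
      _ = ‖B‖ * ‖g‖ ^ 2 * (1 / ((k + 1 : ℕ) : ℝ) ^ 4) := by ring
  have hstep (k : ℕ) : (2 * (k : ℝ) + 1) ^ 6 * ⟪((R k) ^ 2) g, g⟫ ≤ 81 / 2 *
      (((2 * (k : ℝ) + 1) ^ 3 * ⟪R k g, g⟫ - (2 * ((k + 1 : ℕ) : ℝ) + 1) ^ 3 * ⟪R (k + 1) g, g⟫)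
        + 13 * ⟪(B * R k) g, g⟫) := by
    have hcast : 2 * ((k + 1 : ℕ) : ℝ) + 1 = 2 * (k : ℝ) + 1 + 2 := by push_cast; ring
    have h1 := hR (k + 1)
    rw [hcast] at h1 ⊢
    exact resolvent_telescoping hB hpos (hn k) (hR k).1 h1.2 h1.1 g
  have hbound (N : ℕ) : ∑ k ∈ Finset.range N, (2 * (k : ℝ) + 1) ^ 6 * ⟪((R k) ^ 2) g, g⟫ ≤
      567 * ∑' k : ℕ, ⟪(B * R k) g, g⟫ := by
    refine (Finset.sum_le_sum fun k _ ↦ hstep k).trans ?_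
    rw [← Finset.mul_sum, Finset.sum_add_distrib, ← Finset.mul_sum,
      Finset.sum_range_sub' (fun k : ℕ ↦ (2 * (k : ℝ) + 1) ^ 3 * ⟪R k g, g⟫)]
    have h1 := hsum.sum_le_tsum (Finset.range N) fun k _ ↦ hψ k
    have h2 := (hφψ 0).trans (hsum.le_tsum 0 fun k _ ↦ hψ k)
    have h3 : 0 ≤ (2 * (N : ℝ) + 1) ^ 3 * ⟪R N g, g⟫ := mul_nonneg (by positivity) (hφ N)
    norm_num at h1 h2 h3 ⊢
    linarith
  by_cases hL : Summable fun k : ℕ ↦ (2 * (k : ℝ) + 1) ^ 6 * ⟪((R k) ^ 2) g, g⟫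
  · exact le_of_tendsto' hL.hasSum.tendsto_sum_nat hbound
  · rw [tsum_eq_zero_of_not_summable hL]
    exact mul_nonneg (by norm_num) (tsum_nonneg hψ)
end

section
/- Let μ be a probability measure on ℝⁿ satisfying a Poincaré inequality with constant C_P and suppose its potential V (μ = e^{−V}dx) has L-Lipschitz gradient, V of class C². Then L·C_P ≥ 1. -/
open MeasureTheory

open Filter Topology

section Cutoff

variable {E : Type*} [NormedAddCommGroup E] [InnerProductSpace ℝ E] [FiniteDimensional ℝ E]

/-- A sequence of smooth compactly supported cutoffs converging to `1`, with derivatives of size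
`O(1 / k)` supported where `‖x‖ = O(k)`. -/
theorem exists_smooth_cutoff_seq :
    ∃ (C : ℝ) (χ : ℕ → E → ℝ), 0 ≤ C ∧ (∀ k, ContDiff ℝ (⊤ : ℕ∞) (χ k)) ∧
      (∀ k, HasCompactSupport (χ k)) ∧ (∀ k x, 0 ≤ χ k x) ∧ (∀ k x, χ k x ≤ 1) ∧
      (∀ k x, ‖fderiv ℝ (χ k) x‖ ≤ C) ∧ (∀ k x, ‖x‖ * ‖fderiv ℝ (χ k) x‖ ≤ C) ∧
      (∀ x, Tendsto (fun k => χ k x) atTop (𝓝 1)) ∧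
      (∀ x, Tendsto (fun k => fderiv ℝ (χ k) x) atTop (𝓝 0)) := by
  let b : ContDiffBump (0 : E) := ⟨1, 2, one_pos, one_lt_two⟩
  have hb : ContDiff ℝ (⊤ : ℕ∞) b := b.contDiff
  obtain ⟨D, hD⟩ := (b.hasCompactSupport.fderiv ℝ).exists_bound_of_continuous
    (hb.continuous_fderiv (by simp))
  have hD0 : 0 ≤ D := (norm_nonneg _).trans (hD 0)
  let r : ℕ → ℝ := fun k => 1 / ((k : ℝ) + 1)
  have hr : ∀ k, 0 < r k := fun k => Nat.one_div_pos_of_nat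
  have hr1 : ∀ k, r k ≤ 1 := fun k => by
    rw [div_le_one (by positivity)]
    linarith [k.cast_nonneg (α := ℝ)]
  have hr0 : Tendsto r atTop (𝓝 0) := tendsto_one_div_add_atTop_nhds_zero_nat
  have hfd : ∀ k x, fderiv ℝ (fun y => b (r k • y)) x = r k • fderiv ℝ b (r k • x) :=
    fun k x => fderiv_comp_smul (r k)
  have hnorm : ∀ k x, ‖fderiv ℝ (fun y => b (r k • y)) x‖ ≤ r k * D := fun k x => by
    rw [hfd, norm_smul, Real.norm_of_nonneg (hr k).le]
    exact mul_le_mul_of_nonneg_left (hD _) (hr k).le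
  refine ⟨2 * D, fun k x => b (r k • x), by positivity,
    fun k => hb.comp (contDiff_const_smul (r k)),
    fun k => b.hasCompactSupport.comp_smul (hr k).ne', fun k x => b.nonneg, fun k x => b.le_one,
    fun k x => (hnorm k x).trans ?_, fun k x => ?_, fun x => ?_, fun x => ?_⟩
  · nlinarith [hr1 k]
  · rw [hfd, norm_smul, Real.norm_of_nonneg (hr k).le]
    by_cases h : ‖r k • x‖ ≤ 2
    · rw [norm_smul, Real.norm_of_nonneg (hr k).le] at h
      calc ‖x‖ * (r k * ‖fderiv ℝ b (r k • x)‖) = r k * ‖x‖ * ‖fderiv ℝ b (r k • x)‖ := by ring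
        _ ≤ 2 * D := mul_le_mul h (hD _) (norm_nonneg _) zero_le_two
    · have : r k • x ∉ tsupport b := by
        rw [b.tsupport_eq]
        simpa using h
      have h0 : fderiv ℝ b (r k • x) = 0 := by
        by_contra h'
        exact this (support_fderiv_subset ℝ h')
      simp [h0, hD0]
  · have h1 : Tendsto (fun k => r k • x) atTop (𝓝 0) := by simpa using hr0.smul_const x
    have h2 := (hb.continuous.tendsto 0).comp h1
    rwa [b.one_of_mem_closedBall (by simp [b.rIn_pos.le])] at h2
  · exact squeeze_zero_norm (hnorm · x) (by simpa using hr0.mul_const D)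

end Cutoff

/-- The Cauchy–Schwarz inequality for real integrals. -/
theorem sq_integral_mul_le {α : Type*} [MeasurableSpace α] {μ : Measure α} {f g : α → ℝ}
    (hf : Integrable (fun x => f x ^ 2) μ) (hg : Integrable (fun x => g x ^ 2) μ)
    (hfg : Integrable (fun x => f x * g x) μ) :
    (∫ x, f x * g x ∂μ) ^ 2 ≤ (∫ x, f x ^ 2 ∂μ) * ∫ x, g x ^ 2 ∂μ := by
  have key : ∀ t : ℝ, 0 ≤ (∫ x, f x ^ 2 ∂μ) * (t * t) + (2 * ∫ x, f x * g x ∂μ) * t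
      + ∫ x, g x ^ 2 ∂μ := fun t => by
    have h : ∫ x, (t * f x + g x) ^ 2 ∂μ = (∫ x, f x ^ 2 ∂μ) * (t * t)
        + (2 * ∫ x, f x * g x ∂μ) * t + ∫ x, g x ^ 2 ∂μ := by
      have : (fun x => (t * f x + g x) ^ 2)
          = fun x => (t * t) * f x ^ 2 + (2 * t) * (f x * g x) + g x ^ 2 := by
        ext x; ring
      have hI : Integrable (fun x => (t * t) * f x ^ 2 + (2 * t) * (f x * g x)) μ :=
        (hf.const_mul _).add (hfg.const_mul _)
      rw [this, integral_add hI hg, integral_add (hf.const_mul _) (hfg.const_mul _),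
        integral_const_mul, integral_const_mul]
      ring
    rw [← h]
    exact integral_nonneg fun x => sq_nonneg _
  have := discrim_le_zero key
  rw [discrim] at this
  linarith

theorem tendsto_integral_of_bounded {α : Type*} [MeasurableSpace α] {μ : Measure α}
    [IsFiniteMeasure μ] {F : ℕ → α → ℝ} {f : α → ℝ} (C : ℝ)
    (hF : ∀ k, AEStronglyMeasurable (F k) μ) (hC : ∀ k x, |F k x| ≤ C)
    (hlim : ∀ x, Tendsto (fun k => F k x) atTop (𝓝 (f x))) :
    Tendsto (fun k => ∫ x, F k x ∂μ) atTop (𝓝 (∫ x, f x ∂μ)) :=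
  tendsto_integral_of_dominated_convergence (fun _ => C) hF (integrable_const C)
    (fun k => Eventually.of_forall (hC k)) (Eventually.of_forall hlim)

section Score

variable {E : Type*} [NormedAddCommGroup E] [InnerProductSpace ℝ E] [FiniteDimensional ℝ E]
  [MeasurableSpace E] [BorelSpace E]

/-- Integration by parts against the density `exp (-V)`. -/
theorem integral_fderiv_withDensity_exp_neg {V : E → ℝ} (hV : ContDiff ℝ 1 V) {g : E → ℝ}
    (hg : ContDiff ℝ 1 g) (hgc : HasCompactSupport g) (e : E) :
    ∫ x, fderiv ℝ g x e ∂(volume.withDensity fun x => ENNReal.ofReal (Real.exp (-V x)))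
      = ∫ x, g x * fderiv ℝ V x e
          ∂(volume.withDensity fun x => ENNReal.ofReal (Real.exp (-V x))) := by
  have hVc := hV.continuous
  have hVd : Continuous fun x => fderiv ℝ V x e :=
    (hV.continuous_fderiv one_ne_zero).clm_apply continuous_const
  have hgd : Continuous fun x => fderiv ℝ g x e :=
    (hg.continuous_fderiv one_ne_zero).clm_apply continuous_const
  have hm : Measurable fun x => ENNReal.ofReal (Real.exp (-V x)) := by fun_prop
  have hVdiff := hV.differentiable one_ne_zero
  have hfd : ∀ x, fderiv ℝ (fun x => Real.exp (-V x)) x e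
      = -(Real.exp (-V x) * fderiv ℝ V x e) := fun x => by
    rw [((hVdiff x).hasFDerivAt.fun_neg.exp).fderiv]
    simp
  simp only [integral_withDensity_eq_integral_toReal_smul hm
    (Eventually.of_forall fun x => ENNReal.ofReal_lt_top),
    ENNReal.toReal_ofReal (Real.exp_pos _).le, smul_eq_mul]
  have key := integral_mul_fderiv_eq_neg_fderiv_mul_of_integrable (μ := (volume : Measure E))
    (f := fun x => Real.exp (-V x)) (g := g) (v := e) ?_ ?_ ?_
    (fun x _ => (hVdiff x).fun_neg.exp) (fun x _ => hg.differentiable one_ne_zero x)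
  · rw [key, ← integral_neg]
    refine integral_congr_ae (Eventually.of_forall fun x => ?_)
    simp only [hfd]
    ring
  · simp only [hfd]
    exact Continuous.integrable_of_hasCompactSupport (by fun_prop) hgc.mul_left
  · exact Continuous.integrable_of_hasCompactSupport (by fun_prop)
      (hgc.fderiv_apply ℝ e).mul_left
  · exact Continuous.integrable_of_hasCompactSupport (by fun_prop) hgc.mul_left

/-- Cramér–Rao: if `W` is the score of `μ` in the direction `e` and `∂ₑ W ≤ L`, then
`(∫ ∂ₑ f)² ≤ L Var f`. -/
theorem sq_integral_fderiv_le_mul_variance {μ : Measure E} [IsProbabilityMeasure μ] {e : E}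
    (he : ‖e‖ = 1) {W : E → ℝ} (hW : ContDiff ℝ 1 W) {A L : ℝ} (hL : 0 ≤ L)
    (hWd : ∀ x, fderiv ℝ W x e ≤ L) (hWb : ∀ x, |W x| ≤ A + L * ‖x‖)
    (hibp : ∀ g : E → ℝ, ContDiff ℝ 1 g → HasCompactSupport g →
      ∫ x, fderiv ℝ g x e ∂μ = ∫ x, g x * W x ∂μ)
    {f : E → ℝ} (hf : ContDiff ℝ 1 f) (hfc : HasCompactSupport f) :
    (∫ x, fderiv ℝ f x e ∂μ) ^ 2 ≤ L * ((∫ x, f x ^ 2 ∂μ) - (∫ x, f x ∂μ) ^ 2) := by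
  obtain ⟨C, χ, hC, hχ, hχc, hχ0, hχ1, hdC, hxdC, hlim, hdlim⟩ := exists_smooth_cutoff_seq (E := E)
  have hχ' : ∀ k, ContDiff ℝ 1 (χ k) := fun k => (hχ k).of_le (by exact_mod_cast le_top)
  have hA : 0 ≤ A := by simpa using (abs_nonneg _).trans (hWb 0)
  have happ : ∀ {l : E →L[ℝ] ℝ}, |l e| ≤ ‖l‖ := fun {l} => by
    simpa [he] using l.le_opNorm e
  have hχcont := fun k => (hχ' k).continuous
  have hWcont := hW.continuous
  have hfcont := hf.continuous
  have hdcont : ∀ {g : E → ℝ}, ContDiff ℝ 1 g → Continuous fun x => fderiv ℝ g x e := fun hg =>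
    (hg.continuous_fderiv one_ne_zero).clm_apply continuous_const
  have hdχ := fun k => hdcont (hχ' k)
  have hdf := hdcont hf
  have hdW := hdcont hW
  have hdlim' : ∀ x, Tendsto (fun k => fderiv ℝ (χ k) x e) atTop (𝓝 0) := fun x =>
    squeeze_zero_norm (fun k => happ) (by simpa using (hdlim x).norm)
  -- The localized Fisher information is at most `L` plus a vanishing error.
  let h : ℕ → ℝ := fun k => ∫ x, 2 * χ k x * fderiv ℝ (χ k) x e * W x ∂μ
  have hh : Tendsto h atTop (𝓝 0) := by
    have := tendsto_integral_of_bounded (μ := μ)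
      (F := fun k x => 2 * χ k x * fderiv ℝ (χ k) x e * W x) (f := fun _ => 0)
      (2 * (A * C + L * C))
      (fun k => by
        have := hχcont k
        have := hdχ k
        exact Continuous.aestronglyMeasurable (by fun_prop))
      (fun k x => ?_) (fun x => ?_)
    · simpa using this
    · have h1 : |fderiv ℝ (χ k) x e| * |W x| ≤ A * C + L * C := by
        calc |fderiv ℝ (χ k) x e| * |W x| ≤ ‖fderiv ℝ (χ k) x‖ * (A + L * ‖x‖) :=
              mul_le_mul happ (hWb x) (abs_nonneg _) (norm_nonneg _)
          _ = A * ‖fderiv ℝ (χ k) x‖ + L * (‖x‖ * ‖fderiv ℝ (χ k) x‖) := by ring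
          _ ≤ _ := add_le_add (mul_le_mul_of_nonneg_left (hdC k x) hA)
              (mul_le_mul_of_nonneg_left (hxdC k x) hL)
      rw [abs_mul, abs_mul, abs_mul, abs_of_nonneg (hχ0 k x), abs_two]
      have h2 := mul_le_mul (hχ1 k x) h1 (by positivity) zero_le_one
      linarith
    · simpa using (((hlim x).const_mul 2).mul (hdlim' x)).mul_const (W x)
  have hfisher : ∀ k, ∫ x, (χ k x * W x) ^ 2 ∂μ ≤ L + h k := fun k => by
    have := hχcont k
    have := hdχ k
    have hc2 : HasCompactSupport fun x => χ k x * (χ k x * W x) := (hχc k).mul_right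
    have hI : Integrable (fun x => 2 * χ k x * fderiv ℝ (χ k) x e * W x) μ :=
      Continuous.integrable_of_hasCompactSupport (by fun_prop)
        ((hχc k).mul_left.mul_right.mul_right)
    have hI' : Integrable (fun x => χ k x * (χ k x * fderiv ℝ W x e)) μ :=
      Continuous.integrable_of_hasCompactSupport (by fun_prop) (hχc k).mul_right
    have hfd : ∀ x, fderiv ℝ (fun x => χ k x * (χ k x * W x)) x e
        = χ k x * (χ k x * fderiv ℝ W x e) + 2 * χ k x * fderiv ℝ (χ k) x e * W x := fun x => by
      have h1 := ((hχ' k).differentiable one_ne_zero x).hasFDerivAt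
      have h2 := (hW.differentiable one_ne_zero x).hasFDerivAt
      rw [(h1.fun_mul (h1.fun_mul h2)).fderiv]
      simp
      ring
    calc ∫ x, (χ k x * W x) ^ 2 ∂μ = ∫ x, χ k x * (χ k x * W x) * W x ∂μ := by
          congr 1; ext x; ring
      _ = ∫ x, fderiv ℝ (fun x => χ k x * (χ k x * W x)) x e ∂μ :=
          (hibp _ ((hχ' k).mul ((hχ' k).mul hW)) hc2).symm
      _ = (∫ x, χ k x * (χ k x * fderiv ℝ W x e) ∂μ) + h k := by
          simp only [hfd]
          exact integral_add hI' hI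
      _ ≤ (∫ _, L ∂μ) + h k := by
          refine add_le_add_left (integral_mono hI' (integrable_const L) fun x => ?_) _
          have h1 : χ k x * χ k x ≤ 1 := mul_le_one₀ (hχ1 k x) (hχ0 k x) (hχ1 k x)
          have h2 : 0 ≤ χ k x * χ k x := mul_self_nonneg _
          nlinarith [hWd x]
      _ = L + h k := by simp
  have hfI : Integrable f μ := hfcont.integrable_of_hasCompactSupport hfc
  have hf2I : Integrable (fun x => f x ^ 2) μ :=
    Continuous.integrable_of_hasCompactSupport (by fun_prop)
      (hfc.comp_left (g := (· ^ 2)) (by simp))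
  set c := ∫ x, f x ∂μ with hc
  have hexp : (fun x => (f x - c) ^ 2) = fun x => f x ^ 2 - 2 * c * f x + c ^ 2 := by
    ext x; ring
  have hI1 : Integrable (fun x => f x ^ 2 - 2 * c * f x) μ := hf2I.sub (hfI.const_mul _)
  have hvarI : Integrable (fun x => (f x - c) ^ 2) μ := by
    rw [hexp]
    exact hI1.add (integrable_const _)
  have hvar : ∫ x, (f x - c) ^ 2 ∂μ = (∫ x, f x ^ 2 ∂μ) - c ^ 2 := by
    rw [hexp, integral_add hI1 (integrable_const _), integral_sub hf2I (hfI.const_mul _),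
      integral_const_mul, ← hc]
    simp
    ring
  let u : ℕ → ℝ := fun k => ∫ x, (f x - c) * (χ k x * W x) ∂μ
  have hu : Tendsto u atTop (𝓝 (∫ x, fderiv ℝ f x e ∂μ)) := by
    obtain ⟨B, hB⟩ := hfc.exists_bound_of_continuous hfcont
    obtain ⟨D, hD⟩ := (hfc.fderiv_apply ℝ e).exists_bound_of_continuous hdf
    have hueq : ∀ k, u k
        = ∫ x, (χ k x * fderiv ℝ f x e + (f x - c) * fderiv ℝ (χ k) x e) ∂μ := fun k => by
      have hfd : ∀ x, fderiv ℝ (fun x => (f x - c) * χ k x) x e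
          = χ k x * fderiv ℝ f x e + (f x - c) * fderiv ℝ (χ k) x e := fun x => by
        have h1 := ((hχ' k).differentiable one_ne_zero x).hasFDerivAt
        have h2 := (hf.differentiable one_ne_zero x).hasFDerivAt
        rw [((h2.sub_const c).fun_mul h1).fderiv]
        simp
        ring
      have := hibp (fun x => (f x - c) * χ k x) ((hf.sub contDiff_const).mul (hχ' k))
        (hχc k).mul_left
      simp only [hfd] at this
      rw [this]
      simp only [u, mul_assoc]
    rw [funext hueq]
    refine tendsto_integral_of_bounded (D + (B + |c|) * C)
      (fun k => by
        have := hχcont k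
        have := hdχ k
        exact Continuous.aestronglyMeasurable (by fun_prop))
      (fun k x => ?_) (fun x => ?_)
    · refine (abs_add_le _ _).trans (add_le_add ?_ ?_)
      · rw [abs_mul, abs_of_nonneg (hχ0 k x)]
        have h1 := mul_le_mul (hχ1 k x) (hD x) (norm_nonneg _) zero_le_one
        simpa using h1
      · rw [abs_mul]
        exact mul_le_mul ((abs_sub _ _).trans (add_le_add_left (hB x) _))
          (happ.trans (hdC k x)) (abs_nonneg _)
          (add_nonneg ((norm_nonneg _).trans (hB x)) (abs_nonneg c))
    · simpa using ((hlim x).mul_const (fderiv ℝ f x e)).add ((hdlim' x).const_mul (f x - c))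
  rw [← hvar, mul_comm]
  refine le_of_tendsto_of_tendsto' (hu.pow 2)
    (by simpa using (hh.const_add L).const_mul (∫ x, (f x - c) ^ 2 ∂μ)) fun k => ?_
  have := hχcont k
  refine (sq_integral_mul_le hvarI ?_ ?_).trans
    (mul_le_mul_of_nonneg_left (hfisher k) (integral_nonneg fun x => sq_nonneg _))
  · refine Continuous.integrable_of_hasCompactSupport (by fun_prop) ?_
    exact ((hχc k).mul_right (f' := W)).comp_left (g := (· ^ 2)) (by simp)
  · exact Continuous.integrable_of_hasCompactSupport (by fun_prop) (hχc k).mul_right.mul_left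

/-- The linear functional `⟪e, ·⟫` is approximated by smooth compactly supported functions whose
derivatives converge in mean and in mean square. -/
theorem exists_seq_tendsto_integral_fderiv (μ : Measure E) [IsProbabilityMeasure μ] {e : E}
    (he : ‖e‖ = 1) :
    ∃ f : ℕ → E → ℝ, (∀ k, ContDiff ℝ (⊤ : ℕ∞) (f k)) ∧ (∀ k, HasCompactSupport (f k)) ∧
      Tendsto (fun k => ∫ x, fderiv ℝ (f k) x e ∂μ) atTop (𝓝 1) ∧
      Tendsto (fun k => ∫ x, ‖fderiv ℝ (f k) x‖ ^ 2 ∂μ) atTop (𝓝 1) := by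
  obtain ⟨C, χ, hC, hχ, hχc, hχ0, hχ1, hdC, hxdC, hlim, hdlim⟩ := exists_smooth_cutoff_seq (E := E)
  let l : E →L[ℝ] ℝ := innerSL ℝ e
  have hl : ‖l‖ = 1 := by rw [innerSL_apply_norm, he]
  have hle : l e = 1 := by simp [l, he]
  have hsm : ∀ k, ContDiff ℝ (⊤ : ℕ∞) fun x => l x * χ k x := fun k => l.contDiff.mul (hχ k)
  have hfd : ∀ k x, fderiv ℝ (fun x => l x * χ k x) x = l x • fderiv ℝ (χ k) x + χ k x • l :=
    fun k x => (l.hasFDerivAt.fun_mul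
      ((hχ k).differentiable (by simp) x).hasFDerivAt).fderiv
  have hcont : ∀ k, Continuous (fderiv ℝ (fun x => l x * χ k x)) := fun k =>
    (hsm k).continuous_fderiv (by simp)
  have hbound : ∀ k x, ‖fderiv ℝ (fun x => l x * χ k x) x‖ ≤ C + 1 := fun k x => by
    rw [hfd]
    refine (norm_add_le _ _).trans (add_le_add ?_ ?_)
    · rw [norm_smul]
      refine (mul_le_mul_of_nonneg_right ?_ (norm_nonneg _)).trans (hxdC k x)
      simpa [hl] using l.le_opNorm x
    · rw [norm_smul, hl, mul_one, Real.norm_of_nonneg (hχ0 k x)]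
      exact hχ1 k x
  have hconv : ∀ x, Tendsto (fun k => fderiv ℝ (fun x => l x * χ k x) x) atTop (𝓝 l) := fun x => by
    simp only [hfd]
    simpa using ((hdlim x).const_smul (l x)).add ((hlim x).smul_const l)
  refine ⟨fun k x => l x * χ k x, hsm, fun k => (hχc k).mul_left, ?_, ?_⟩
  · have := tendsto_integral_of_bounded (μ := μ)
      (F := fun k x => fderiv ℝ (fun x => l x * χ k x) x e) (f := fun _ => l e) (C + 1)
      (fun k => ((hcont k).clm_apply continuous_const).aestronglyMeasurable) (fun k x => ?_)
      (fun x => ((ContinuousLinearMap.apply ℝ ℝ e).continuous.tendsto l).comp (hconv x))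
    · simpa [hle] using this
    · refine le_trans ?_ (hbound k x)
      simpa [he] using (fderiv ℝ (fun x => l x * χ k x) x).le_opNorm e
  · have := tendsto_integral_of_bounded (μ := μ)
      (F := fun k x => ‖fderiv ℝ (fun x => l x * χ k x) x‖ ^ 2) (f := fun _ => ‖l‖ ^ 2)
      ((C + 1) ^ 2) (fun k => ((hcont k).norm.pow 2).aestronglyMeasurable) (fun k x => ?_)
      (fun x => (hconv x).norm.pow 2)
    · simpa [hl] using this
    · rw [abs_of_nonneg (by positivity)]
      exact pow_le_pow_left₀ (norm_nonneg _) (hbound k x) 2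

end Score

/-- If `μ = e^{-V} dx` is a probability measure on `ℝⁿ` (`n ≥ 1`) satisfying
Poincaré with constant `C_P` and `∇V` is `L`-Lipschitz, then `L C_P ≥ 1`. -/
theorem lipschitz_mul_poincare_ge_one
    (n : ℕ) (hn : 0 < n)
    (V : EuclideanSpace ℝ (Fin n) → ℝ) (hV : ContDiff ℝ 2 V)
    (L CP : ℝ) (hL : 0 ≤ L)
    (hLip : LipschitzWith (Real.toNNReal L) (gradient V))
    (μ : Measure (EuclideanSpace ℝ (Fin n)))
    (hμ : μ = volume.withDensity (fun x => ENNReal.ofReal (Real.exp (-V x))))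
    [IsProbabilityMeasure μ]
    (hPoincare : ∀ f : EuclideanSpace ℝ (Fin n) → ℝ,
      ContDiff ℝ (⊤ : ℕ∞) f → HasCompactSupport f →
      (∫ x, (f x) ^ 2 ∂μ) - (∫ x, f x ∂μ) ^ 2 ≤ CP * ∫ x, ‖gradient f x‖ ^ 2 ∂μ) :
    1 ≤ L * CP := by
  let e : EuclideanSpace ℝ (Fin n) := EuclideanSpace.single ⟨0, hn⟩ 1
  have he : ‖e‖ = 1 := by simp [e]
  let W : EuclideanSpace ℝ (Fin n) → ℝ := fun x => fderiv ℝ V x e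
  have hW : ContDiff ℝ 1 W :=
    (hV.fderiv_right (by norm_num)).clm_apply contDiff_const
  have hWlip : LipschitzWith (Real.toNNReal L) W := by
    refine LipschitzWith.of_dist_le_mul fun x y => ?_
    have h1 : W x - W y = inner ℝ (gradient V x - gradient V y) e := by
      rw [inner_sub_left, inner_gradient_left, inner_gradient_left]
    rw [Real.dist_eq, h1]
    refine (abs_real_inner_le_norm _ _).trans ?_
    rw [he, mul_one, ← dist_eq_norm]
    exact hLip.dist_le_mul x y
  have hWd : ∀ x, fderiv ℝ W x e ≤ L := fun x => by
    have h1 := norm_fderiv_le_of_lipschitz ℝ (x₀ := x) hWlip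
    rw [Real.coe_toNNReal L hL] at h1
    have h2 := (fderiv ℝ W x).le_opNorm e
    rw [he, mul_one] at h2
    exact (le_abs_self _).trans (h2.trans h1)
  have hWb : ∀ x, |W x| ≤ |W 0| + L * ‖x‖ := fun x => by
    have h1 := hWlip.dist_le_mul x 0
    rw [Real.coe_toNNReal L hL, Real.dist_eq, dist_zero_right] at h1
    have h2 := abs_sub_abs_le_abs_sub (W x) (W 0)
    linarith
  have hibp : ∀ g : EuclideanSpace ℝ (Fin n) → ℝ, ContDiff ℝ 1 g → HasCompactSupport g →
      ∫ x, fderiv ℝ g x e ∂μ = ∫ x, g x * W x ∂μ := fun g hg hgc => by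
    rw [hμ]
    exact integral_fderiv_withDensity_exp_neg (hV.of_le one_le_two) hg hgc e
  obtain ⟨f, hf, hfc, hmean, hsq⟩ := exists_seq_tendsto_integral_fderiv μ he
  refine le_of_tendsto_of_tendsto' (by simpa using hmean.pow 2)
    (by simpa using (hsq.const_mul CP).const_mul L) fun k => ?_
  refine (sq_integral_fderiv_le_mul_variance he hW hL hWd hWb hibp
    ((hf k).of_le (by exact_mod_cast le_top)) (hfc k)).trans
    (mul_le_mul_of_nonneg_left ?_ hL)
  have hgrad : ∀ x, ‖gradient (f k) x‖ = ‖fderiv ℝ (f k) x‖ := fun x => by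
    rw [← toDual_gradient, LinearIsometryEquiv.norm_map]
  simpa only [hgrad] using hPoincare (f k) (hf k) (hfc k)
end
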